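/- arXiv:2307.13515 — 2 statements merged into one kernel-verified Lean document; each statement's English description precedes it below -/
import Mathlib

section
/- Let T > 0 and let h : [0,T] × ℝ → ℝ be an L¹-Carathéodory function such that h(t,s) > 0 for a.e. t ∈ [0,T] and all s < 0. Then every solution u of u'' + h(t,u) = 0 on (0,T) with boundary conditions u(T) = u(0) and u'(0) = 0 satisfies u(t) ≥ 0 for all t ∈ [0,T]. -/
open MeasureTheory Set Filter

noncomputable section

/-- Lebesgue measure restricted to `[0,T]`. -/
def muT (T : ℝ) : Measure ℝ := volume.restrict (Icc 0 T)

/-- `u` is a solution of `u'' + h(t,u) = 0` on `[0,T]`: `u` is `C¹` on `[0,T]` with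
derivative `u'`, and `u'` is absolutely continuous with a.e. second derivative
`-h(t,u(t))`, expressed in integral form. -/
def IsSolutionODE1 (T : ℝ) (h : ℝ → ℝ → ℝ) (u u' : ℝ → ℝ) : Prop :=
  (∀ t ∈ Icc (0:ℝ) T, HasDerivWithinAt u (u' t) (Icc (0:ℝ) T) t) ∧
  IntegrableOn (fun s => h s (u s)) (Icc (0:ℝ) T) ∧
  (∀ t ∈ Icc (0:ℝ) T, u' t = u' 0 - ∫ s in (0:ℝ)..t, h s (u s))

/-- `h` is an `L¹`-Carathéodory function on `[0,T] × ℝ`. -/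
def IsL1Caratheodory2 (T : ℝ) (h : ℝ → ℝ → ℝ) : Prop :=
  (∀ s : ℝ, Measurable fun t => h t s) ∧
  (∀ᵐ t ∂(muT T), Continuous fun s => h t s) ∧
  (∀ R : ℝ, 0 < R → ∃ η : ℝ → ℝ, IntegrableOn η (Icc (0:ℝ) T) ∧
    ∀ᵐ t ∂(muT T), ∀ s : ℝ, |s| ≤ R → |h t s| ≤ η t)

/-- The integral of an integrable function that is a.e. positive on a nondegenerate interval is
positive. -/
theorem intervalIntegral_pos_of_ae_pos {f : ℝ → ℝ} {a b : ℝ} (hab : a < b)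
    (hf : IntervalIntegrable f volume a b)
    (hpos : ∀ᵐ t ∂(volume.restrict (Ioc a b)), 0 < f t) :
    0 < ∫ t in a..b, f t := by
  have hnonneg : 0 ≤ᵐ[volume.restrict (uIoc a b)] f := by
    rw [uIoc_of_le hab.le]
    exact hpos.mono fun _ h => h.le
  rw [intervalIntegral.integral_pos_iff_support_of_nonneg_ae' hnonneg hf]
  refine ⟨hab, ?_⟩
  have hae : Ioc a b ≤ᵐ[volume] (Function.support f ∩ Ioc a b : Set ℝ) := by
    filter_upwards [(ae_restrict_iff' measurableSet_Ioc).1 hpos] with t ht hmem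
    exact ⟨(ht hmem).ne', hmem⟩
  refine lt_of_lt_of_le ?_ (measure_mono_ae hae)
  simpa using hab

/-- A solution has a decreasing derivative where it is negative: if `u < 0` on `[a,b]`, then
`u' b < u' a`. -/
theorem IsSolutionODE1.deriv_lt_of_neg {T : ℝ} {h : ℝ → ℝ → ℝ} {u u' : ℝ → ℝ}
    (hsol : IsSolutionODE1 T h u u')
    (hpos : ∀ᵐ t ∂(muT T), ∀ s : ℝ, s < 0 → 0 < h t s)
    {a b : ℝ} (ha : 0 ≤ a) (hab : a < b) (hb : b ≤ T) (hneg : ∀ t ∈ Icc a b, u t < 0) :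
    u' b < u' a := by
  obtain ⟨-, hint, hu'⟩ := hsol
  have integrable_of_mem {c d : ℝ} (hc : 0 ≤ c) (hcd : c ≤ d) (hd : d ≤ T) :
      IntervalIntegrable (fun s => h s (u s)) volume c d :=
    (intervalIntegrable_iff_integrableOn_Icc_of_le hcd).2 (hint.mono_set (Icc_subset_Icc hc hd))
  have hadd := intervalIntegral.integral_add_adjacent_intervals
    (integrable_of_mem le_rfl ha (hab.le.trans hb)) (integrable_of_mem ha hab.le hb)
  have hgt : 0 < ∫ s in a..b, h s (u s) := by
    refine intervalIntegral_pos_of_ae_pos hab (integrable_of_mem ha hab.le hb) ?_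
    have hsub : Ioc a b ⊆ Icc 0 T := fun t ht => ⟨ha.trans ht.1.le, ht.2.trans hb⟩
    filter_upwards [ae_restrict_of_ae_restrict_of_subset hsub hpos,
      ae_restrict_mem measurableSet_Ioc] with t ht hmem
    exact ht _ (hneg t (Ioc_subset_Icc_self hmem))
  linarith [hu' a ⟨ha, hab.le.trans hb⟩, hu' b ⟨ha.trans hab.le, hb⟩]

/-- **Maximum principle (i), boundary conditions `u(T) = u(0)`, `u'(0) = 0`.** -/
theorem max_principle_nonneg_second_bc
    (T : ℝ) (hT : 0 < T) (h : ℝ → ℝ → ℝ)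
    (hCar : IsL1Caratheodory2 T h)
    (hpos : ∀ᵐ t ∂(muT T), ∀ s : ℝ, s < 0 → 0 < h t s)
    (u u' : ℝ → ℝ) (hsol : IsSolutionODE1 T h u u')
    (hbc1 : u T = u 0) (hbc2 : u' 0 = 0) :
    ∀ t ∈ Icc (0:ℝ) T, 0 ≤ u t := by
  have hderiv := hsol.1
  have hcont : ContinuousOn u (Icc 0 T) := fun t ht => (hderiv t ht).continuousWithinAt
  obtain ⟨m, hm, hmT, hmin⟩ : ∃ m, 0 ≤ m ∧ m < T ∧ ∀ t ∈ Icc (0:ℝ) T, u m ≤ u t := by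
    obtain ⟨m, hm, hmin⟩ := isCompact_Icc.exists_isMinOn (nonempty_Icc.2 hT.le) hcont
    rcases hm.2.eq_or_lt with rfl | hlt
    · exact ⟨0, le_rfl, hT, fun t ht => hbc1 ▸ hmin ht⟩
    · exact ⟨m, hm.1, hlt, fun t ht => hmin ht⟩
  have hm' : u' m = 0 := by
    rcases hm.eq_or_lt with rfl | hlt
    · exact hbc2
    · have hnhds : Icc 0 T ∈ nhds m := Icc_mem_nhds hlt hmT
      have hloc : IsLocalMin u m := by
        filter_upwards [hnhds] with t ht using hmin t ht
      exact hloc.hasDerivAt_eq_zero ((hderiv m ⟨hm, hmT.le⟩).hasDerivAt hnhds)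
  by_contra! hcon
  obtain ⟨t, ht, hut⟩ := hcon
  have hum : u m < 0 := (hmin t ht).trans_lt hut
  obtain ⟨b, hmb, hbT, hneg⟩ : ∃ b, m < b ∧ b ≤ T ∧ ∀ t ∈ Icc m b, u t < 0 := by
    have hright : ∀ᶠ t in nhdsWithin m (Ici m), u t < 0 :=
      ((hcont m ⟨hm, hmT.le⟩).mono_of_mem_nhdsWithin
        (mem_of_superset (Icc_mem_nhdsGE hmT) (Icc_subset_Icc_left hm))).eventually_lt_const hum
    obtain ⟨b, ⟨hmb, hbT⟩, hb⟩ := (mem_nhdsGE_iff_exists_mem_Ioc_Ico_subset hmT).1 hright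
    refine ⟨(m + b) / 2, by linarith, by linarith, fun t ht => hb ⟨ht.1, ?_⟩⟩
    linarith [ht.2]
  obtain ⟨c, ⟨hmc, hcb⟩, hc⟩ := exists_hasDerivAt_eq_slope u u' hmb
    (hcont.mono (Icc_subset_Icc hm hbT)) fun x hx =>
      (hderiv x ⟨hm.trans hx.1.le, hx.2.le.trans hbT⟩).hasDerivAt
        (Icc_mem_nhds (hm.trans_lt hx.1) (hx.2.trans_le hbT))
  have hslope : 0 ≤ u' c := by
    rw [hc]
    exact div_nonneg (sub_nonneg.2 (hmin b ⟨hm.trans hmb.le, hbT⟩)) (sub_nonneg.2 hmb.le)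
  have hdecr := hsol.deriv_lt_of_neg hpos hm hmc (hcb.le.trans hbT)
    fun t ht => hneg t ⟨ht.1, ht.2.trans hcb.le⟩
  linarith
end
end

section
/- Let T > 0 and let h : [0,T] × ℝ → ℝ be an L¹-Carathéodory function with h(t,0) = 0 for a.e. t ∈ [0,T], and suppose there exists q ∈ L¹([0,T],[0,∞)) such that limsup_{s→0⁺} |h(t,s)|/s ≤ q(t) uniformly for a.e. t ∈ [0,T], i.e. for every ε > 0 there exists δ > 0 such that |h(t,s)| ≤ (q(t)+ε)s for a.e. t ∈ [0,T] and all s ∈ (0,δ). Then every solution u of u'' + h(t,u) = 0 on (0,T) with boundary conditions u'(T) = u'(0) and u(0) = 0, satisfying u(t) ≥ 0 for all t ∈ [0,T] and u not identically zero, satisfies u(t) > 0 for every t ∈ (0,T]. -/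
open MeasureTheory Set Filter

noncomputable section

/-- First-order optimality condition on a compact interval, endpoints included. -/
theorem deriv_mul_sub_nonneg_of_isMinOn {a b x y d : ℝ} {u : ℝ → ℝ}
    (hx : x ∈ Icc a b) (hy : y ∈ Icc a b) (hd : HasDerivWithinAt u d (Icc a b) x)
    (hmin : ∀ t ∈ Icc a b, u x ≤ u t) : 0 ≤ d * (y - x) := by
  have hloc : IsLocalMinOn u (Icc a b) x := by
    filter_upwards [self_mem_nhdsWithin] with t ht using hmin t ht
  have hcone : y - x ∈ posTangentConeAt (Icc a b) x := by
    apply sub_mem_posTangentConeAt_of_segment_subset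
    exact (convex_Icc a b).segment_subset hx hy
  have := hloc.hasFDerivWithinAt_nonneg hd.hasFDerivWithinAt hcone
  simpa [mul_comm] using this

/-- The derivative of a solution is an integral between any two points of the interval. -/
theorem IsSolutionODE1.deriv_sub_deriv {T : ℝ} {h : ℝ → ℝ → ℝ} {u u' : ℝ → ℝ}
    (hsol : IsSolutionODE1 T h u u') {x y : ℝ} (hx : x ∈ Icc 0 T) (hy : y ∈ Icc 0 T) :
    u' y - u' x = -∫ s in x..y, h s (u s) := by
  obtain ⟨-, hint, hu'⟩ := hsol
  have hii : ∀ z ∈ Icc 0 T, IntervalIntegrable (fun s => h s (u s)) volume 0 z := fun z hz => by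
    rw [intervalIntegrable_iff_integrableOn_Icc_of_le hz.1]
    exact hint.mono_set (Icc_subset_Icc_right hz.2)
  rw [← intervalIntegral.integral_interval_sub_left (hii y hy) (hii x hx), hu' x hx, hu' y hy]
  ring

theorem IsSolutionODE1.continuousOn_deriv {T : ℝ} {h : ℝ → ℝ → ℝ} {u u' : ℝ → ℝ}
    (hsol : IsSolutionODE1 T h u u') : ContinuousOn u' (Icc 0 T) := by
  rcases lt_or_ge T 0 with hT | hT
  · simp [Icc_eq_empty_of_lt hT]
  have hprim := intervalIntegral.continuousOn_primitive_interval
    (f := fun s => h s (u s)) (a := 0) (b := T) (μ := volume)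
    (by rw [uIcc_of_le hT]; exact hsol.2.1)
  rw [uIcc_of_le hT] at hprim
  exact (continuousOn_const.sub hprim).congr hsol.2.2

/-- Near a double zero, a nonnegative solution vanishes as soon as the nonlinearity is dominated
along it by an integrable multiple of the solution. -/
theorem IsSolutionODE1.eventually_eq_zero {T δ : ℝ} {h : ℝ → ℝ → ℝ} {u u' p : ℝ → ℝ}
    (hsol : IsSolutionODE1 T h u u') (hp : IntegrableOn p (Icc 0 T)) (hp0 : ∀ t, 0 ≤ p t)
    (hδ : 0 < δ) (hnonneg : ∀ t ∈ Icc 0 T, 0 ≤ u t)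
    (hbound : ∀ᵐ t ∂(muT T), ∀ s, 0 ≤ s → s < δ → |h t s| ≤ p t * s)
    {x : ℝ} (hx : x ∈ Icc 0 T) (hux : u x = 0) (hu'x : u' x = 0) :
    ∀ᶠ t in nhdsWithin x (Icc 0 T), u t = 0 ∧ u' t = 0 := by
  have hT : 0 ≤ T := hx.1.trans hx.2
  have hpii : IntervalIntegrable p volume 0 T := by
    rwa [intervalIntegrable_iff_integrableOn_Icc_of_le hT]
  have hprim : ContinuousOn (fun t => ∫ s in x..t, p s) (Icc 0 T) := by
    have := intervalIntegral.continuousOn_primitive_interval' hpii (a := x)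
      (by rwa [uIcc_of_le hT])
    rwa [uIcc_of_le hT] at this
  have hucont : ContinuousOn u (Icc 0 T) := fun t ht => (hsol.1 t ht).continuousWithinAt
  have hsmall : ∀ᶠ t in nhdsWithin x (Icc 0 T), u t < δ ∧ T * |∫ s in x..t, p s| < 1 / 2 := by
    refine ((hucont x hx).eventually_lt_const (by rwa [hux])).and ?_
    have hc : ContinuousWithinAt (fun t => T * |∫ s in x..t, p s|) (Icc 0 T) x :=
      ((hprim x hx).abs).const_mul T
    exact hc.eventually_lt_const (by simp)
  obtain ⟨ε, hε, hball⟩ := (nhdsWithin_hasBasis Metric.nhds_basis_closedBall _).eventually_iff.1 hsmall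
  set J := Metric.closedBall x ε ∩ Icc 0 T with hJ
  have hxJ : x ∈ J := ⟨Metric.mem_closedBall_self hε.le, hx⟩
  have hJsub : J ⊆ Icc 0 T := inter_subset_right
  have hJconv : Convex ℝ J := (convex_closedBall x ε).inter (convex_Icc 0 T)
  have hJcomp : IsCompact J := (isCompact_closedBall x ε).inter isCompact_Icc
  obtain ⟨z, hz, hzmax⟩ :=
    hJcomp.exists_isMaxOn ⟨x, hxJ⟩ (hsol.continuousOn_deriv.mono hJsub).abs
  have hmax : ∀ t ∈ J, |u' t| ≤ |u' z| := fun t ht => hzmax ht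
  have hu : ∀ t ∈ J, u t ≤ |u' z| * T := fun t ht => by
    have h1 := hJconv.norm_image_sub_le_of_norm_hasDerivWithin_le
      (fun s hs => (hsol.1 s (hJsub hs)).mono hJsub) hmax hxJ ht
    rw [hux, sub_zero, Real.norm_eq_abs, Real.norm_eq_abs] at h1
    refine (le_abs_self _).trans (h1.trans (mul_le_mul_of_nonneg_left ?_ (abs_nonneg _)))
    rw [abs_le]
    constructor <;> linarith [(hJsub ht).1, (hJsub ht).2, hx.1, hx.2]
  have hxz : uIoc x z ⊆ J := uIoc_subset_uIcc.trans
    (by rw [← segment_eq_uIcc]; exact hJconv.segment_subset hxJ hz)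
  have hae : ∀ᵐ t ∂(volume.restrict (uIoc x z)), ‖h t (u t)‖ ≤ |u' z| * T * p t := by
    have h1 := ae_restrict_of_ae_restrict_of_subset (hxz.trans hJsub) hbound
    filter_upwards [h1, ae_restrict_mem measurableSet_uIoc] with t ht htm
    have htJ := hxz htm
    calc ‖h t (u t)‖ ≤ p t * u t := ht _ (hnonneg t (hJsub htJ)) (hball htJ).1
      _ ≤ p t * (|u' z| * T) := mul_le_mul_of_nonneg_left (hu t htJ) (hp0 t)
      _ = |u' z| * T * p t := mul_comm _ _
  have hpxz : IntervalIntegrable p volume x z := hpii.mono_set (by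
    rw [uIcc_of_le hT]; exact (ordConnected_Icc.uIcc_subset hx (hJsub hz)))
  have hle := intervalIntegral.norm_integral_le_abs_of_norm_le hae (hpxz.const_mul (|u' z| * T))
  have hdz : u' z = -∫ s in x..z, h s (u s) := by
    rw [← hsol.deriv_sub_deriv hx (hJsub hz), hu'x, sub_zero]
  rw [intervalIntegral.integral_const_mul, abs_mul, abs_mul, abs_abs, abs_of_nonneg hT,
    ← norm_neg, ← hdz, Real.norm_eq_abs] at hle
  have hz0 : |u' z| = 0 := by
    nlinarith [(hball hz).2, abs_nonneg (u' z)]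
  have hmem : J ∈ nhdsWithin x (Icc 0 T) :=
    by
    rw [hJ, inter_comm]
    exact inter_mem_nhdsWithin _ (Metric.closedBall_mem_nhds x hε)
  filter_upwards [hmem] with t ht
  refine ⟨le_antisymm ?_ (hnonneg t (hJsub ht)), ?_⟩
  · simpa [hz0] using hu t ht
  · simpa [hz0] using hmax t ht

/-- A nonnegative solution with a double zero is trivial. -/
theorem IsSolutionODE1.eq_zero_of_double_zero {T δ : ℝ} {h : ℝ → ℝ → ℝ} {u u' p : ℝ → ℝ}
    (hsol : IsSolutionODE1 T h u u') (hp : IntegrableOn p (Icc 0 T)) (hp0 : ∀ t, 0 ≤ p t)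
    (hδ : 0 < δ) (hnonneg : ∀ t ∈ Icc 0 T, 0 ≤ u t)
    (hbound : ∀ᵐ t ∂(muT T), ∀ s, 0 ≤ s → s < δ → |h t s| ≤ p t * s)
    {x : ℝ} (hx : x ∈ Icc 0 T) (hux : u x = 0) (hu'x : u' x = 0) :
    ∀ t ∈ Icc 0 T, u t = 0 := by
  have hucont : ContinuousOn u (Icc 0 T) := fun t ht => (hsol.1 t ht).continuousWithinAt
  let Z : Set (Icc 0 T) := {t | u t = 0 ∧ u' t = 0}
  have hclosed : IsClosed Z :=
    (isClosed_eq hucont.domRestrict continuous_const).inter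
      (isClosed_eq hsol.continuousOn_deriv.domRestrict continuous_const)
  have hopen : IsOpen Z := isOpen_iff_mem_nhds.2 fun t ht =>
    (nhdsWithin_eq_map_subtype_coe t.2 ▸
      hsol.eventually_eq_zero hp hp0 hδ hnonneg hbound t.2 ht.1 ht.2 :
      ∀ᶠ s in map ((↑) : Icc 0 T → ℝ) (nhds t), u s = 0 ∧ u' s = 0)
  have : PreconnectedSpace (Icc 0 T) := Subtype.preconnectedSpace isPreconnected_Icc
  have huniv : Z = univ := IsClopen.eq_univ ⟨hclosed, hopen⟩ ⟨⟨x, hx⟩, hux, hu'x⟩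
  exact fun t ht => (huniv ▸ mem_univ (⟨t, ht⟩ : Icc 0 T) : (⟨t, ht⟩ : Icc 0 T) ∈ Z).1

/-- **Maximum principle (ii), boundary conditions `u'(T) = u'(0)`, `u(0) = 0`.** -/
theorem max_principle_pos_third_bc
    (T : ℝ) (hT : 0 < T) (h : ℝ → ℝ → ℝ)
    (hCar : IsL1Caratheodory2 T h)
    (hzero : ∀ᵐ t ∂(muT T), h t 0 = 0)
    (q : ℝ → ℝ) (hq0 : ∀ t, 0 ≤ q t) (hqInt : IntegrableOn q (Icc (0:ℝ) T))
    (hlimsup : ∀ ε : ℝ, 0 < ε → ∃ δ : ℝ, 0 < δ ∧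
      ∀ᵐ t ∂(muT T), ∀ s : ℝ, 0 < s → s < δ → |h t s| ≤ (q t + ε) * s)
    (u u' : ℝ → ℝ) (hsol : IsSolutionODE1 T h u u')
    (hbc1 : u' T = u' 0) (hbc2 : u 0 = 0)
    (hnonneg : ∀ t ∈ Icc (0:ℝ) T, 0 ≤ u t)
    (hnotzero : ¬ ∀ t ∈ Icc (0:ℝ) T, u t = 0) :
    ∀ t ∈ Ioc (0:ℝ) T, 0 < u t := by
  intro x hx
  have hxI : x ∈ Icc 0 T := ⟨hx.1.le, hx.2⟩
  refine (hnonneg x hxI).lt_of_ne' fun hux => hnotzero ?_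
  have h0I : (0 : ℝ) ∈ Icc 0 T := left_mem_Icc.2 hT.le
  have hTI : T ∈ Icc 0 T := right_mem_Icc.2 hT.le
  have hslope : ∀ t ∈ Icc 0 T, ∀ y ∈ Icc 0 T, u t = 0 → 0 ≤ u' t * (y - t) :=
    fun t ht y hy hut => deriv_mul_sub_nonneg_of_isMinOn ht hy (hsol.1 t ht)
      fun s hs => hut ▸ hnonneg s hs
  have hu'x : u' x = 0 := by
    have hle : u' x ≤ 0 := by nlinarith [hslope x hxI 0 h0I hux, hx.1]
    refine le_antisymm hle ?_
    rcases hx.2.lt_or_eq with hxT | rfl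
    · nlinarith [hslope x hxI T hTI hux]
    · rw [hbc1]
      nlinarith [hslope 0 h0I x hTI hbc2]
  obtain ⟨δ, hδ, hlim⟩ := hlimsup 1 one_pos
  refine hsol.eq_zero_of_double_zero (p := fun t => q t + 1)
    (hqInt.add (integrableOn_const (by simp)))
    (fun t => by linarith [hq0 t]) hδ hnonneg ?_ hxI hux hu'x
  filter_upwards [hlim, hzero] with t ht ht0 s hs hsδ
  rcases hs.eq_or_lt with rfl | hs
  · simp [ht0]
  · exact ht s hs hsδ
end
end
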